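/- Let F2 and F3 be finite subsets of ℤ². Let F1 be a uniquely determined neighbour of F2 and let F1' be a uniquely determined neighbour of F3. Put α_2 = α(F1, F2), α_3 = α(F1', F3) and α_1 = α(F1, F1'). Then |F2 △ F3| ≤ α_2·√(8|F2| + 1) − α_2 + α_3·√(8|F3| + 1) − α_3 + 2α_1·√(2α_1 + 1) − α_1. -/

import Mathlib

open Finset

/-- The row sum `r_i(F)`: the number of elements of `F` in row `i`. -/
def rowSum (F : Finset (ℤ × ℤ)) (i : ℤ) : ℤ :=
  ((F.filter fun p => p.1 = i).card : ℤ)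

/-- The column sum `c_j(F)`: the number of elements of `F` in column `j`. -/
def colSum (F : Finset (ℤ × ℤ)) (j : ℤ) : ℤ :=
  ((F.filter fun p => p.2 = j).card : ℤ)

/-- `F` is uniquely determined by its line sums. -/
def uniquelyDetermined (F : Finset (ℤ × ℤ)) : Prop :=
  ∀ F' : Finset (ℤ × ℤ),
    (∀ i, rowSum F' i = rowSum F i) → (∀ j, colSum F' j = colSum F j) → F' = F

/-- `Σ_j |c_j(F1) − c_j(F2)| + Σ_i |r_i(F1) − r_i(F2)|`; the sums over all of `ℤ`
reduce to the finite index sets below, since all other terms vanish. -/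
def lineDiff (F1 F2 : Finset (ℤ × ℤ)) : ℤ :=
  (∑ j ∈ (F1 ∪ F2).image Prod.snd, |colSum F1 j - colSum F2 j|)
    + ∑ i ∈ (F1 ∪ F2).image Prod.fst, |rowSum F1 i - rowSum F2 i|

/-- `α(F1, F2)`. -/
noncomputable def alpha (F1 F2 : Finset (ℤ × ℤ)) : ℝ :=
  (lineDiff F1 F2 : ℝ) / 2

/-- `F1` is a uniquely determined neighbour of `F2`: `F1` is uniquely determined by
its line sums, has the same row sums as `F2` in every row, and for some `n` such that
the column sums of both `F1` and `F2` are supported in columns `1, …, n`, there is a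
permutation `σ` of `{1, …, n}` ordering the column sums of `F2` non-increasingly
which also orders the column sums of `F1` non-increasingly. -/
def udNeighbour (F1 F2 : Finset (ℤ × ℤ)) : Prop :=
  uniquelyDetermined F1 ∧ (∀ i, rowSum F1 i = rowSum F2 i) ∧
    ∃ n : ℕ,
      (∀ j : ℤ, j < 1 ∨ (n : ℤ) < j → colSum F2 j = 0) ∧
      (∀ j : ℤ, j < 1 ∨ (n : ℤ) < j → colSum F1 j = 0) ∧
      ∃ σ : Equiv.Perm (Fin n),
        (∀ k l : Fin n, k ≤ l →
          colSum F2 ((σ l : ℕ) + 1 : ℤ) ≤ colSum F2 ((σ k : ℕ) + 1 : ℤ)) ∧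
        (∀ k l : Fin n, k ≤ l →
          colSum F1 ((σ l : ℕ) + 1 : ℤ) ≤ colSum F1 ((σ k : ℕ) + 1 : ℤ))

open scoped symmDiff

section Paths

variable {V : Type*} {r : V → V → Prop}

/-- There is a walk with `n` steps along `r` that ends in the given vertex. -/
def HasWalkTo (r : V → V → Prop) : ℕ → V → Prop
  | 0, _ => True
  | n + 1, v => ∃ u, HasWalkTo r n u ∧ r u v

theorem HasWalkTo.of_succ {n : ℕ} {v : V} (h : HasWalkTo r (n + 1) v) : HasWalkTo r n v := by
  induction n generalizing v with
  | zero => trivial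
  | succ n ih =>
    obtain ⟨u, hu, huv⟩ := h
    exact ⟨u, ih hu, huv⟩

theorem HasWalkTo.of_le {m n : ℕ} {v : V} (h : HasWalkTo r n v) (hmn : m ≤ n) :
    HasWalkTo r m v := by
  induction n, hmn using Nat.le_induction with
  | base => exact h
  | succ n _ ih => exact ih h.of_succ

theorem HasWalkTo.exists_seq {n : ℕ} {v : V} (h : HasWalkTo r n v) :
    ∃ w : ℕ → V, ∀ s < n, r (w s) (w (s + 1)) := by
  suffices H : ∃ w : ℕ → V, w n = v ∧ ∀ s < n, r (w s) (w (s + 1)) from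
    H.imp fun _ hw => hw.2
  induction n generalizing v with
  | zero => exact ⟨fun _ => v, rfl, by simp⟩
  | succ n ih =>
    obtain ⟨u, hu, huv⟩ := h
    obtain ⟨w, hwn, hw⟩ := ih hu
    refine ⟨fun s => if s ≤ n then w s else v, by simp, fun s hs => ?_⟩
    rcases Nat.lt_succ_iff_lt_or_eq.mp hs with hs | rfl
    · simpa [hs.le, Nat.succ_le_of_lt hs] using hw s hs
    · simpa [hwn] using huv

theorem HasWalkTo.along_seq {w : ℕ → V} {L : ℕ} (hw : ∀ s < L, r (w s) (w (s + 1)))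
    {n s d : ℕ} (h : HasWalkTo r n (w s)) (hd : s + d ≤ L) :
    HasWalkTo r (n + d) (w (s + d)) := by
  induction d with
  | zero => exact h
  | succ d ih => exact ⟨w (s + d), ih (by omega), hw _ (by omega)⟩

/-- A relation containing the composite of any three of its steps. -/
def ThreeStep (r : V → V → Prop) : Prop :=
  ∀ ⦃a b c d⦄, r a b → r b c → r c d → r a d

theorem ThreeStep.odd_step (hr : ThreeStep r) {w : ℕ → V} {L : ℕ}
    (hw : ∀ s < L, r (w s) (w (s + 1))) {a b : ℕ} (hab : a < b) (hb : b ≤ L)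
    (hodd : Odd (b - a)) : r (w a) (w b) := by
  obtain ⟨d, hd⟩ := hodd
  obtain rfl : b = a + 2 * d + 1 := by omega
  clear hab hd
  induction d with
  | zero => exact hw a (by omega)
  | succ d ih =>
    exact hr (ih (by omega)) (hw _ (by omega)) (hw (a + 2 * (d + 1)) (by omega))

theorem ThreeStep.ne_of_lt (hr : ThreeStep r) (hasymm : ∀ ⦃a b⦄, r a b → ¬ r b a)
    {w : ℕ → V} {L : ℕ} (hw : ∀ s < L, r (w s) (w (s + 1))) {a b : ℕ} (hab : a < b)
    (hb : b ≤ L) : w a ≠ w b := by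
  intro h
  rcases Nat.even_or_odd (b - a) with hev | hodd
  · have h2 : a + 2 ≤ b := by
      obtain ⟨d, hd⟩ := hev
      omega
    have h1 := hr.odd_step hw (a := a) (b := b - 1) (by omega) (by omega) (by
      obtain ⟨d, hd⟩ := hev
      exact ⟨d - 1, by omega⟩)
    have h3 := hw (b - 1) (by omega)
    rw [Nat.sub_add_cancel (by omega), ← h] at h3
    exact hasymm h1 h3
  · have h1 := hr.odd_step hw hab hb hodd
    rw [← h] at h1
    exact hasymm h1 h1

end Paths

/-- Rows `Sum.inl i` and columns `Sum.inr j` are compared by membership of `(i, j)` in `F`: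
a column is related to the rows it meets, a row to the columns it misses. -/
def lineRel (F : Finset (ℤ × ℤ)) : ℤ ⊕ ℤ → ℤ ⊕ ℤ → Prop
  | .inr j, .inl i => (i, j) ∈ F
  | .inl i, .inr j => (i, j) ∉ F
  | _, _ => False

/-- The orientation of the points of `F ∆ G`, seen as edges between their rows and columns. -/
def diffRel (F G : Finset (ℤ × ℤ)) (u v : ℤ ⊕ ℤ) : Prop :=
  lineRel F u v ∧ lineRel G v u

theorem lineRel_asymm (F : Finset (ℤ × ℤ)) ⦃u v : ℤ ⊕ ℤ⦄ (h : lineRel F u v) :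
    ¬ lineRel F v u := by
  rcases u with i | j <;> rcases v with i' | j' <;> simp_all [lineRel]

theorem mem_of_uniquelyDetermined {F : Finset (ℤ × ℤ)} (hF : uniquelyDetermined F)
    {i i' j j' : ℤ} (h1 : (i, j) ∈ F) (h2 : (i, j') ∉ F) (h3 : (i', j') ∈ F) :
    (i', j) ∈ F := by
  by_contra h4
  have hi : i ≠ i' := by rintro rfl; exact h2 h3
  have hj : j ≠ j' := by rintro rfl; exact h2 h1
  set G := (F.erase (i', j')).erase (i, j) with hG
  have hFG : F = insert (i, j) (insert (i', j') G) := by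
    rw [hG]
    ext p
    by_cases hp : p = (i, j) <;> by_cases hp' : p = (i', j') <;> simp_all
  have hcard (P : ℤ × ℤ → Prop) [DecidablePred P] (H : Finset (ℤ × ℤ)) :
      ((H.filter P).card : ℤ) = ∑ p ∈ H, if P p then 1 else 0 := by simp
  have hd : (i, j) ∉ insert (i', j') G := by simp [hG, hi]
  have hd' : (i', j') ∉ G := by simp [hG]
  have he : (i, j') ∉ insert (i', j) G := by simp [hG, hi, h2]
  have he' : (i', j) ∉ G := by simp [hG, h4]
  have key := hF (insert (i, j') (insert (i', j) G))
    (fun k => by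
      rw [rowSum, rowSum, hcard, hcard, hFG, sum_insert he, sum_insert he', sum_insert hd,
        sum_insert hd'])
    (fun k => by
      rw [colSum, colSum, hcard, hcard, hFG, sum_insert he, sum_insert he', sum_insert hd,
        sum_insert hd']
      ring)
  exact h2 (key ▸ mem_insert_self _ _)

theorem threeStep_lineRel {F : Finset (ℤ × ℤ)} (hF : uniquelyDetermined F) :
    ThreeStep (lineRel F) := by
  rintro (i | j) (i' | j') (k | l) (k' | l') h1 h2 h3 <;> simp only [lineRel] at *
  · exact fun h => h1 (mem_of_uniquelyDetermined hF (i := k) h2 h3 h)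
  · exact mem_of_uniquelyDetermined hF h1 h2 h3

theorem threeStep_diffRel {F G : Finset (ℤ × ℤ)} (hF : uniquelyDetermined F)
    (hG : uniquelyDetermined G) : ThreeStep (diffRel F G) :=
  fun _ _ _ _ h1 h2 h3 =>
    ⟨threeStep_lineRel hF h1.1 h2.1 h3.1, threeStep_lineRel hG h3.2 h2.2 h1.2⟩

/-- A walk with `2 * k` steps produces a staircase with `k` steps in `F`. -/
theorem exists_staircase {F : Finset (ℤ × ℤ)} (hF : uniquelyDetermined F)
    {w : ℕ → ℤ ⊕ ℤ} {k : ℕ} (hw : ∀ s < 2 * k, lineRel F (w s) (w (s + 1))) :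
    ∃ r c : ℕ → ℤ, ∀ x < k, ∀ y < k, ((r y, c x) ∈ F ↔ x ≤ y) := by
  rcases Nat.eq_zero_or_pos k with rfl | hk
  · exact ⟨0, 0, by simp⟩
  obtain ⟨o, ho, j₀, hj₀⟩ : ∃ o ≤ 1, ∃ j, w o = .inr j := by
    have h0 := hw 0 (by omega)
    rcases h : w 0 with i | j
    · rcases h' : w 1 with i' | j'
      · simp [h, h', lineRel] at h0
      · exact ⟨1, le_rfl, j', h'⟩
    · exact ⟨0, by simp, j, h⟩
  have h3 := threeStep_lineRel hF
  have hrow : ∀ y < k, ∃ i, w (2 * y + 1 + o) = .inl i := fun y hy => by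
    have h := h3.odd_step hw (a := o) (b := 2 * y + 1 + o) (by omega) (by omega)
      ⟨y, by omega⟩
    rcases h' : w (2 * y + 1 + o) with i | j
    · exact ⟨i, rfl⟩
    · simp [hj₀, h', lineRel] at h
  have hcol : ∀ x < k, ∃ j, w (2 * x + o) = .inr j := fun x hx => by
    obtain ⟨i, hi⟩ := hrow x hx
    have h := hw (2 * x + o) (by omega)
    rw [show 2 * x + o + 1 = 2 * x + 1 + o by ring] at h
    rcases h' : w (2 * x + o) with i' | j
    · simp [hi, h', lineRel] at h
    · exact ⟨j, rfl⟩
  choose! r hr using hrow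
  choose! c hc using hcol
  refine ⟨r, c, fun x hx y hy => ⟨fun h => ?_, fun h => ?_⟩⟩
  · by_contra! hlt
    have h' := h3.odd_step hw (a := 2 * y + 1 + o) (b := 2 * x + o) (by omega) (by omega)
      ⟨x - y - 1, by omega⟩
    rw [hr y hy, hc x hx] at h'
    exact h' h
  · have h' := h3.odd_step hw (a := 2 * x + o) (b := 2 * y + 1 + o) (by omega) (by omega)
      ⟨y - x, by omega⟩
    rwa [hr y hy, hc x hx] at h'

theorem mul_succ_le_of_staircase {F : Finset (ℤ × ℤ)} {k : ℕ} {r c : ℕ → ℤ}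
    (h : ∀ x < k, ∀ y < k, ((r y, c x) ∈ F ↔ x ≤ y)) : k * (k + 1) ≤ 2 * F.card := by
  have hr : ∀ y < k, ∀ y' < k, r y = r y' → y ≤ y' := fun y hy y' hy' e =>
    (h y hy y' hy').1 (e ▸ (h y hy y hy).2 le_rfl)
  have hc : ∀ x < k, ∀ x' < k, c x = c x' → x' ≤ x := fun x hx x' hx' e =>
    (h x' hx' x hx).1 (e ▸ (h x hx x hx).2 le_rfl)
  have hle : ((range k).sigma fun y => range (y + 1)).card ≤ F.card := by
    refine card_le_card_of_injOn (fun p => (r p.1, c p.2)) ?_ ?_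
    · rintro ⟨y, x⟩ hp
      simp only [coe_sigma, Set.mem_sigma_iff, coe_range, Set.mem_Iio] at hp
      exact (h x (by omega) y hp.1).2 (by omega)
    · rintro ⟨y, x⟩ hp ⟨y', x'⟩ hp' e
      simp only [coe_sigma, Set.mem_sigma_iff, coe_range, Set.mem_Iio] at hp hp'
      simp only [Prod.mk.injEq] at e
      have h1 := hr y hp.1 y' hp'.1 e.1
      have h2 := hr y' hp'.1 y hp.1 e.1.symm
      have h3 := hc x (by omega) x' (by omega) e.2
      have h4 := hc x' (by omega) x (by omega) e.2.symm
      obtain rfl : y = y' := by omega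
      obtain rfl : x = x' := by omega
      rfl
  have hsum : ((range k).sigma fun y => range (y + 1)).card * 2 = k * (k + 1) := by
    rw [card_sigma]
    simp only [card_range]
    have h := Finset.sum_range_id_mul_two (k + 1)
    rw [Finset.sum_range_succ'] at h
    simp only [add_zero, Nat.add_sub_cancel] at h
    rw [h]; ring
  omega

theorem HasWalkTo.mul_succ_le {F G : Finset (ℤ × ℤ)} (hF : uniquelyDetermined F) {k : ℕ}
    {v : ℤ ⊕ ℤ} (h : HasWalkTo (diffRel F G) (2 * k) v) : k * (k + 1) ≤ 2 * F.card := by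
  obtain ⟨w, hw⟩ := h.exists_seq
  obtain ⟨r, c, hrc⟩ := exists_staircase hF fun s hs => (hw s hs).1
  exact mul_succ_le_of_staircase hrc

/-- There is a longest walk in `diffRel F G`. -/
theorem exists_maximal_walk {F G : Finset (ℤ × ℤ)} (hF : uniquelyDetermined F) :
    ∃ L, (∃ v, HasWalkTo (diffRel F G) L v) ∧ ∀ v, ¬ HasWalkTo (diffRel F G) (L + 1) v := by
  by_contra! H
  have hall : ∀ n, ∃ v, HasWalkTo (diffRel F G) n v := fun n => by
    induction n with
    | zero => exact ⟨.inl 0, trivial⟩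
    | succ n ih => exact H n ih
  obtain ⟨v, hv⟩ := hall (2 * (2 * F.card + 1))
  nlinarith [hv.mul_succ_le hF]

theorem sum_comp_fst_eq (F S : Finset (ℤ × ℤ)) (hS : F ⊆ S) (f : ℤ → ℤ) :
    ∑ p ∈ F, f p.1 = ∑ i ∈ S.image Prod.fst, rowSum F i * f i := by
  rw [← sum_fiberwise_of_maps_to (g := Prod.fst) (t := S.image Prod.fst)
    fun p hp => mem_image_of_mem _ (hS hp)]
  refine sum_congr rfl fun i _ => ?_
  rw [sum_congr rfl fun p hp => by rw [(mem_filter.mp hp).2], sum_const, nsmul_eq_mul]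
  rfl

theorem sum_comp_snd_eq (F S : Finset (ℤ × ℤ)) (hS : F ⊆ S) (f : ℤ → ℤ) :
    ∑ p ∈ F, f p.2 = ∑ j ∈ S.image Prod.snd, colSum F j * f j := by
  rw [← sum_fiberwise_of_maps_to (g := Prod.snd) (t := S.image Prod.snd)
    fun p hp => mem_image_of_mem _ (hS hp)]
  refine sum_congr rfl fun i _ => ?_
  rw [sum_congr rfl fun p hp => by rw [(mem_filter.mp hp).2], sum_const, nsmul_eq_mul]
  rfl

/-- The starting vertex of the edge `p`, which leaves its column if `p ∈ F` and its row
otherwise. -/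
def edgeTail (F : Finset (ℤ × ℤ)) (p : ℤ × ℤ) : ℤ ⊕ ℤ := if p ∈ F then .inr p.2 else .inl p.1

/-- The end vertex of the edge `p`; see `edgeTail`. -/
def edgeHead (F : Finset (ℤ × ℤ)) (p : ℤ × ℤ) : ℤ ⊕ ℤ := if p ∈ F then .inl p.1 else .inr p.2

theorem diffRel_edge {F G : Finset (ℤ × ℤ)} {p : ℤ × ℤ} (hp : p ∈ F ∆ G) :
    diffRel F G (edgeTail F p) (edgeHead F p) := by
  rcases mem_symmDiff.mp hp with h | h <;> simp [diffRel, edgeTail, edgeHead, lineRel, h]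

theorem exists_edge_of_diffRel {F G : Finset (ℤ × ℤ)} {u v : ℤ ⊕ ℤ} (h : diffRel F G u v) :
    ∃ p ∈ F ∆ G, edgeTail F p = u ∧ edgeHead F p = v := by
  obtain ⟨h1, h2⟩ := h
  rcases u with i | j <;> rcases v with i' | j' <;> simp only [lineRel] at h1 h2
  · exact ⟨(i, j'), mem_symmDiff.mpr (.inr ⟨h2, h1⟩), by simp [edgeTail, h1],
      by simp [edgeHead, h1]⟩
  · exact ⟨(i', j), mem_symmDiff.mpr (.inl ⟨h1, h2⟩), by simp [edgeTail, h1],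
      by simp [edgeHead, h1]⟩

theorem sum_symmDiff_potential_le (F G : Finset (ℤ × ℤ)) (φ : ℤ ⊕ ℤ → ℤ) (M : ℤ)
    (hφ : ∀ v, |φ v| ≤ M) :
    ∑ p ∈ F ∆ G, (φ (edgeHead F p) - φ (edgeTail F p)) ≤ M * lineDiff F G := by
  have hsplit := sum_sdiff_sub_sum_sdiff (s₁ := G) (s₂ := F)
    (f := fun p => φ (.inl p.1) - φ (.inr p.2))
  have hpos : ∑ p ∈ F \ G, (φ (edgeHead F p) - φ (edgeTail F p))
      = ∑ p ∈ F \ G, (φ (.inl p.1) - φ (.inr p.2)) :=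
    sum_congr rfl fun p hp => by simp [edgeHead, edgeTail, (mem_sdiff.mp hp).1]
  have hneg : ∑ p ∈ G \ F, (φ (edgeHead F p) - φ (edgeTail F p))
      = - ∑ p ∈ G \ F, (φ (.inl p.1) - φ (.inr p.2)) := by
    rw [← sum_neg_distrib]
    exact sum_congr rfl fun p hp => by simp [edgeHead, edgeTail, (mem_sdiff.mp hp).2]
  have hF1 := sum_comp_fst_eq F (F ∪ G) subset_union_left fun i => φ (.inl i)
  have hG1 := sum_comp_fst_eq G (F ∪ G) subset_union_right fun i => φ (.inl i)
  have hF2 := sum_comp_snd_eq F (F ∪ G) subset_union_left fun j => φ (.inr j)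
  have hG2 := sum_comp_snd_eq G (F ∪ G) subset_union_right fun j => φ (.inr j)
  rw [symmDiff_def, sup_eq_union, sum_union disjoint_sdiff_sdiff, hpos, hneg,
    ← sub_eq_add_neg, hsplit, sum_sub_distrib, sum_sub_distrib, hF1, hF2, hG1, hG2,
    sub_sub_sub_comm, ← sum_sub_distrib, ← sum_sub_distrib, lineDiff, mul_add, mul_sum,
    mul_sum, sub_eq_add_neg, ← sum_neg_distrib, add_comm]
  refine add_le_add (sum_le_sum fun j _ => ?_) (sum_le_sum fun i _ => ?_)
  · rw [← sub_mul, mul_comm M]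
    refine (neg_le_abs _).trans ?_
    rw [abs_mul]
    exact mul_le_mul_of_nonneg_left (hφ _) (abs_nonneg _)
  · rw [← sub_mul, mul_comm M]
    refine (le_abs_self _).trans ?_
    rw [abs_mul]
    exact mul_le_mul_of_nonneg_left (hφ _) (abs_nonneg _)

theorem lineDiff_nonneg (F G : Finset (ℤ × ℤ)) : 0 ≤ lineDiff F G :=
  add_nonneg (sum_nonneg fun _ _ => abs_nonneg _) (sum_nonneg fun _ _ => abs_nonneg _)

open Classical in
theorem two_mul_card_symmDiff_le {F G : Finset (ℤ × ℤ)} {L : ℕ}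
    (hL : ∀ v, ¬ HasWalkTo (diffRel F G) (L + 1) v) :
    2 * ((F ∆ G).card : ℤ) ≤ L * lineDiff F G := by
  set lev : ℤ ⊕ ℤ → ℕ := fun v => Nat.findGreatest (HasWalkTo (diffRel F G) · v) L with hlev
  have hstep : ∀ u v, diffRel F G u v → lev u + 1 ≤ lev v := fun u v huv => by
    have hu : HasWalkTo (diffRel F G) (lev u) u :=
      Nat.findGreatest_spec (P := (HasWalkTo (diffRel F G) · u)) (Nat.zero_le L) trivial
    have hv : HasWalkTo (diffRel F G) (lev u + 1) v := ⟨u, hu, huv⟩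
    refine Nat.le_findGreatest ?_ hv
    by_contra! hlt
    exact hL v (hv.of_le hlt)
  refine le_trans ?_ (sum_symmDiff_potential_le F G (fun v => 2 * lev v - L) L fun v => ?_)
  · rw [mul_comm, ← nsmul_eq_mul]
    refine card_nsmul_le_sum _ _ _ fun p hp => ?_
    have := hstep _ _ (diffRel_edge hp)
    omega
  · have : lev v ≤ L := Nat.findGreatest_le L
    rw [abs_le]
    omega

theorem mul_le_two_mul_card_even (p q : ℕ) :
    p * q ≤ 2 * ((range p ×ˢ range q).filter fun x => Even (x.1 + x.2)).card := by
  have h : ∑ x ∈ range p ×ˢ range q, (-1 : ℤ) ^ (x.1 + x.2)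
      = 2 * ((range p ×ˢ range q).filter fun x => Even (x.1 + x.2)).card - p * q := by
    rw [card_filter, Nat.cast_sum, mul_sum]
    have : (p * q : ℤ) = ∑ x ∈ range p ×ˢ range q, 1 := by simp
    rw [this, ← sum_sub_distrib]
    refine sum_congr rfl fun x _ => ?_
    by_cases hx : Even (x.1 + x.2)
    · simp [hx, hx.neg_one_pow]
    · simp [hx, (Nat.not_even_iff_odd.mp hx).neg_one_pow]
  have h' : 0 ≤ ∑ x ∈ range p ×ˢ range q, (-1 : ℤ) ^ (x.1 + x.2) := by
    simp only [pow_add]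
    rw [sum_product, ← sum_mul_sum, neg_one_geom_sum, neg_one_geom_sum]
    positivity
  zify
  linarith

open Classical in
/-- The edges crossing a cut of a longest walk into parts with `p` and `q` vertices. -/
theorem mul_le_lineDiff {F G : Finset (ℤ × ℤ)} (hF : uniquelyDetermined F)
    (hG : uniquelyDetermined G) {p q : ℕ} {v : ℤ ⊕ ℤ} {L : ℕ} (hpq : p + q = L + 1)
    (hv : HasWalkTo (diffRel F G) L v) (hL : ∀ v, ¬ HasWalkTo (diffRel F G) (L + 1) v) :
    (p * q : ℤ) ≤ lineDiff F G := by
  obtain ⟨w, hw⟩ := hv.exists_seq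
  have h3 := threeStep_diffRel hF hG
  have hinj : ∀ a ≤ L, ∀ b ≤ L, w a = w b → a = b := fun a ha b hb hab => by
    have hasymm : ∀ ⦃u v⦄, diffRel F G u v → ¬ diffRel F G v u := fun u v h h' =>
      lineRel_asymm F h.1 h'.1
    rcases lt_trichotomy a b with h | h | h
    · exact absurd hab (h3.ne_of_lt hasymm hw h hb)
    · exact h
    · exact absurd hab.symm (h3.ne_of_lt hasymm hw h ha)
  have hhigh : ∀ b < q, HasWalkTo (diffRel F G) p (w (p + b)) := fun b hb => by
    have h : HasWalkTo (diffRel F G) (0 + (p + b)) (w (0 + (p + b))) :=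
      HasWalkTo.along_seq hw trivial (by omega)
    rw [zero_add] at h
    exact h.of_le (by omega)
  have hlow : ∀ a < p, ¬ HasWalkTo (diffRel F G) p (w (p - 1 - a)) := fun a ha h => by
    have := HasWalkTo.along_seq hw h (d := L - (p - 1 - a)) (by omega)
    exact hL _ (this.of_le (by omega))
  have hedge : ∀ x : ℕ × ℕ, ∃ e, x ∈ (range p ×ˢ range q).filter (fun x => Even (x.1 + x.2)) →
      e ∈ F ∆ G ∧ edgeTail F e = w (p - 1 - x.1) ∧ edgeHead F e = w (p + x.2) := fun x => by
    by_cases hx : x ∈ (range p ×ˢ range q).filter (fun x => Even (x.1 + x.2))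
    · have hx' := hx
      simp only [mem_filter, mem_product, mem_range] at hx'
      obtain ⟨⟨h1, h2⟩, d, hd⟩ := hx'
      obtain ⟨e, he⟩ := exists_edge_of_diffRel <|
        h3.odd_step hw (a := p - 1 - x.1) (b := p + x.2) (by omega) (by omega)
          ⟨d, by omega⟩
      exact ⟨e, fun _ => he⟩
    · exact ⟨0, fun h => absurd h hx⟩
  choose e he using hedge
  set φ : ℤ ⊕ ℤ → ℤ := fun v => if HasWalkTo (diffRel F G) p v then 1 else -1 with hφ
  set C := ((range p ×ˢ range q).filter fun x => Even (x.1 + x.2)).image e with hC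
  have hcard : C.card = ((range p ×ˢ range q).filter fun x => Even (x.1 + x.2)).card := by
    refine card_image_of_injOn fun x hx y hy hxy => ?_
    obtain ⟨-, hx1, hx2⟩ := he x hx
    obtain ⟨-, hy1, hy2⟩ := he y hy
    simp only [coe_filter, mem_product, mem_range, Set.mem_ofPred_eq] at hx hy
    have h1 := hinj _ (by omega) _ (by omega) (hx1.symm.trans (hxy ▸ hy1))
    have h2 := hinj _ (by omega) _ (by omega) (hx2.symm.trans (hxy ▸ hy2))
    ext <;> omega
  have hCsub : C ⊆ F ∆ G := fun c hc => by
    obtain ⟨x, hx, rfl⟩ := mem_image.mp hc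
    exact (he x hx).1
  have hC2 : ∀ c ∈ C, 2 ≤ φ (edgeHead F c) - φ (edgeTail F c) := fun c hc => by
    obtain ⟨x, hx, rfl⟩ := mem_image.mp hc
    obtain ⟨-, hx1, hx2⟩ := he x hx
    simp only [mem_filter, mem_product, mem_range] at hx
    rw [hx1, hx2]
    simp [hφ, hhigh _ hx.1.2, hlow _ hx.1.1]
  have hnonneg : ∀ c ∈ F ∆ G, 0 ≤ φ (edgeHead F c) - φ (edgeTail F c) := fun c hc => by
    by_cases ht : HasWalkTo (diffRel F G) p (edgeTail F c)
    · have hh : HasWalkTo (diffRel F G) p (edgeHead F c) :=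
        HasWalkTo.of_succ ⟨_, ht, diffRel_edge hc⟩
      simp [hφ, ht, hh]
    · simp only [hφ, ht, if_false]
      split_ifs <;> norm_num
  have hsum : (2 * C.card : ℤ) ≤ lineDiff F G := by
    calc (2 * C.card : ℤ) = C.card • (2 : ℤ) := by rw [nsmul_eq_mul, mul_comm]
      _ ≤ ∑ c ∈ C, (φ (edgeHead F c) - φ (edgeTail F c)) := card_nsmul_le_sum _ _ _ hC2
      _ ≤ ∑ c ∈ F ∆ G, (φ (edgeHead F c) - φ (edgeTail F c)) :=
        sum_le_sum_of_subset_of_nonneg hCsub fun c hc _ => hnonneg c hc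
      _ ≤ 1 * lineDiff F G := sum_symmDiff_potential_le F G φ 1 fun v => by
        simp only [hφ]
        split_ifs <;> norm_num
      _ = lineDiff F G := one_mul _
  have heven := mul_le_two_mul_card_even p q
  rw [← hcard] at heven
  zify at heven
  exact heven.trans hsum

theorem alpha_nonneg (F G : Finset (ℤ × ℤ)) : 0 ≤ alpha F G :=
  div_nonneg (Int.cast_nonneg (lineDiff_nonneg F G)) zero_le_two

theorem card_symmDiff_le_alpha_mul {F G : Finset (ℤ × ℤ)} {L : ℕ}
    (hL : ∀ v, ¬ HasWalkTo (diffRel F G) (L + 1) v) {x : ℝ} (hx : ((L : ℝ) + 1) ^ 2 ≤ x) :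
    ((F ∆ G).card : ℝ) ≤ alpha F G * Real.sqrt x - alpha F G := by
  have h : (2 * (F ∆ G).card : ℝ) ≤ L * lineDiff F G := by
    exact_mod_cast two_mul_card_symmDiff_le hL
  have h1 : (L : ℝ) + 1 ≤ Real.sqrt x := Real.le_sqrt_of_sq_le hx
  have h2 := mul_le_mul_of_nonneg_left h1 (alpha_nonneg F G)
  have h3 : (lineDiff F G : ℝ) = 2 * alpha F G := by rw [alpha]; ring
  rw [h3] at h
  linarith

theorem card_symmDiff_le_of_uniquelyDetermined {F G : Finset (ℤ × ℤ)}
    (hF : uniquelyDetermined F) (hG : uniquelyDetermined G) :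
    ((F ∆ G).card : ℝ) ≤ 2 * alpha F G * Real.sqrt (2 * alpha F G + 1) - alpha F G := by
  obtain ⟨L, ⟨v, hv⟩, hL⟩ := exists_maximal_walk (G := G) hF
  have hcut := mul_le_lineDiff hF hG (p := (L + 1) / 2) (q := L + 1 - (L + 1) / 2)
    (by omega) hv hL
  have hsq : ((L : ℤ) + 1) ^ 2 ≤ 4 * lineDiff F G + 1 := by
    obtain ⟨m, hm | hm⟩ := Nat.even_or_odd' (L + 1)
    · rw [hm, show 2 * m / 2 = m by omega, show 2 * m - m = m by omega] at hcut
      have : (L : ℤ) + 1 = 2 * m := by exact_mod_cast hm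
      rw [this]
      linarith
    · rw [hm, show (2 * m + 1) / 2 = m by omega, show 2 * m + 1 - m = m + 1 by omega] at hcut
      have : (L : ℤ) + 1 = 2 * m + 1 := by exact_mod_cast hm
      rw [this]
      push_cast at hcut
      linarith
  have hsqR : ((L : ℝ) + 1) ^ 2 ≤ 2 ^ 2 * (2 * alpha F G + 1) := by
    have h : ((L : ℝ) + 1) ^ 2 ≤ 4 * lineDiff F G + 1 := by exact_mod_cast hsq
    rw [alpha]
    linarith
  have := card_symmDiff_le_alpha_mul hL hsqR
  rw [Real.sqrt_mul (by norm_num), Real.sqrt_sq zero_le_two] at this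
  linarith

theorem card_eq_of_rowSum_eq {F G : Finset (ℤ × ℤ)} (h : ∀ i, rowSum F i = rowSum G i) :
    F.card = G.card := by
  have hF := sum_comp_fst_eq F (F ∪ G) subset_union_left 1
  have hG := sum_comp_fst_eq G (F ∪ G) subset_union_right 1
  simp only [h] at hF
  have := hF.trans hG.symm
  simpa using this

theorem exists_mem_sdiff_of_rowSum_le {F G : Finset (ℤ × ℤ)} {i j : ℤ}
    (h : rowSum F i ≤ rowSum G i) (hj : (i, j) ∈ F \ G) : ∃ j', (i, j') ∈ G \ F := by
  by_contra! H
  rw [mem_sdiff] at hj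
  have hss : (G.filter fun p => p.1 = i) ⊂ F.filter fun p => p.1 = i := by
    refine (ssubset_iff_of_subset ?_).mpr ⟨(i, j), by simp [hj.1], by simp [hj.2]⟩
    rintro ⟨a, b⟩ hp
    obtain ⟨hG, rfl⟩ := mem_filter.mp hp
    refine mem_filter.mpr ⟨?_, rfl⟩
    by_contra hb
    exact H b (mem_sdiff.mpr ⟨hG, hb⟩)
  have := card_lt_card hss
  unfold rowSum at h
  omega

theorem HasWalkTo.extend {F G : Finset (ℤ × ℤ)} (h : ∀ i, rowSum F i = rowSum G i) {k : ℕ}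
    {v : ℤ ⊕ ℤ} (hv : HasWalkTo (diffRel F G) (2 * k + 1) v) :
    ∃ v, HasWalkTo (diffRel F G) (2 * k + 2) v := by
  rcases v with i | j
  · obtain ⟨u, hu, huv⟩ := id hv
    rcases u with i' | j
    · exact absurd huv.1 (by simp [lineRel])
    · obtain ⟨j', hj'⟩ := exists_mem_sdiff_of_rowSum_le (h i).le
        (mem_sdiff.mpr ⟨huv.1, huv.2⟩)
      exact ⟨.inr j', .inl i, hv, (mem_sdiff.mp hj').2, (mem_sdiff.mp hj').1⟩
  · refine ⟨.inr j, ?_⟩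
    induction k generalizing j with
    | zero =>
      obtain ⟨u, -, huv⟩ := hv
      rcases u with i | j'
      · obtain ⟨j', hj'⟩ := exists_mem_sdiff_of_rowSum_le (h i).ge
          (mem_sdiff.mpr ⟨huv.2, huv.1⟩)
        exact ⟨.inl i, ⟨.inr j', trivial, (mem_sdiff.mp hj').1, (mem_sdiff.mp hj').2⟩, huv⟩
      · exact absurd huv.1 (by simp [lineRel])
    | succ k ih =>
      obtain ⟨u, ⟨u', hu', huu⟩, huv⟩ := hv
      rcases u with i | j'
      · rcases u' with i' | j'
        · exact absurd huu.1 (by simp [lineRel])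
        · exact ⟨.inl i, ⟨.inr j', ih j' hu', huu⟩, huv⟩
      · exact absurd huv.1 (by simp [lineRel])

theorem card_symmDiff_le_of_rowSum_eq {F G : Finset (ℤ × ℤ)} (hF : uniquelyDetermined F)
    (h : ∀ i, rowSum F i = rowSum G i) :
    ((F ∆ G).card : ℝ) ≤ alpha F G * Real.sqrt (8 * G.card + 1) - alpha F G := by
  obtain ⟨L, ⟨v, hv⟩, hL⟩ := exists_maximal_walk (G := G) hF
  refine card_symmDiff_le_alpha_mul hL ?_
  obtain ⟨k, rfl | rfl⟩ := Nat.even_or_odd' L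
  · have hk := hv.mul_succ_le hF
    rw [card_eq_of_rowSum_eq h] at hk
    have : (k * (k + 1) : ℝ) ≤ 2 * G.card := by exact_mod_cast hk
    push_cast
    linarith
  · obtain ⟨u, hu⟩ := hv.extend h
    exact absurd hu (hL u)

/-- If `F1` is a uniquely determined neighbour of `F2` and `F1'` is a uniquely
determined neighbour of `F3`, then with `α₂ = α(F1, F2)`, `α₃ = α(F1', F3)` and
`α₁ = α(F1, F1')` we have
`|F2 △ F3| ≤ α₂√(8|F2| + 1) − α₂ + α₃√(8|F3| + 1) − α₃ + 2α₁√(2α₁ + 1) − α₁`. -/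
theorem symmDiff_card_le_of_different_lineSums (F2 F3 F1 F1' : Finset (ℤ × ℤ))
    (hnb2 : udNeighbour F1 F2) (hnb3 : udNeighbour F1' F3) :
    ((F2 ∆ F3).card : ℝ) ≤
      alpha F1 F2 * Real.sqrt (8 * F2.card + 1) - alpha F1 F2
        + alpha F1' F3 * Real.sqrt (8 * F3.card + 1) - alpha F1' F3
        + 2 * alpha F1 F1' * Real.sqrt (2 * alpha F1 F1' + 1) - alpha F1 F1' := by
  have h2 : ((F2 ∆ F1).card : ℝ) ≤ _ :=
    symmDiff_comm F1 F2 ▸ card_symmDiff_le_of_rowSum_eq hnb2.1 hnb2.2.1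
  have h3 := card_symmDiff_le_of_rowSum_eq hnb3.1 hnb3.2.1
  have h1 := card_symmDiff_le_of_uniquelyDetermined hnb2.1 hnb3.1
  have htri (A B C : Finset (ℤ × ℤ)) : (A ∆ C).card ≤ (A ∆ B).card + (B ∆ C).card :=
    (card_le_card (symmDiff_triangle A B C)).trans (card_union_le _ _)
  have h : ((F2 ∆ F3).card : ℝ) ≤ (F2 ∆ F1).card + ((F1 ∆ F1').card + (F1' ∆ F3).card) := by
    exact_mod_cast (htri F2 F1 F3).trans (Nat.add_le_add_left (htri F1 F1' F3) _)
  linarith
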